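/- arXiv:1403.0435 — 8 statements merged into one kernel-verified Lean document; each statement's English description precedes it below -/
import Mathlib

section
/- For every positive integer n and every complex number x, Σ_{0 ≤ k ≤ n, k ≡ 3 (mod 6)} C(n,k) B_{n-k}(x) = (n/6) ( x^{n-1} + (x−1)^{n-1} − (x+ω)^{n-1} − (x+ω²)^{n-1} ). -/
open Finset

/-- The Bernoulli polynomial `B_n(x) = ∑_{k=0}^n C(n,k) B_k x^{n-k}`, evaluated at `x : ℂ`,
where `B_k` are the Bernoulli numbers (`B_1 = -1/2`). -/
noncomputable def bernoulliPoly (n : ℕ) (x : ℂ) : ℂ :=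
  ∑ k ∈ Finset.range (n + 1), (bernoulli k : ℂ) * (n.choose k : ℂ) * x ^ (n - k)

/-- `ω = (-1 + √(-3))/2`, a primitive cube root of unity. -/
noncomputable def ω : ℂ := (-1 + (Real.sqrt 3 : ℂ) * Complex.I) / 2

theorem bernoulliPoly_eq_aeval (n : ℕ) (x : ℂ) :
    bernoulliPoly n x = Polynomial.aeval x (Polynomial.bernoulli n) := by
  rw [Polynomial.bernoulli_def, bernoulliPoly, map_sum, ← sum_range_reflect]
  refine sum_congr rfl fun k hk => ?_
  have hk : k ≤ n := Nat.lt_succ_iff.mp (mem_range.mp hk)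
  rw [Polynomial.aeval_monomial, show n + 1 - 1 - k = n - k by omega, Nat.sub_sub_self hk,
    Nat.choose_symm hk]
  simp

theorem bernoulliPoly_add_one (n : ℕ) (x : ℂ) :
    bernoulliPoly n (x + 1) = bernoulliPoly n x + n * x ^ (n - 1) := by
  have h := congrArg (Polynomial.aeval x) (Polynomial.bernoulli_comp_one_add_X n)
  simp only [Polynomial.aeval_comp, map_add, map_one, Polynomial.aeval_X, nsmul_eq_mul,
    map_mul, map_natCast, map_pow] at h
  rw [bernoulliPoly_eq_aeval, bernoulliPoly_eq_aeval, add_comm x 1, h]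

theorem bernoulliPoly_add (n : ℕ) (x y : ℂ) :
    bernoulliPoly n (x + y) =
      ∑ k ∈ range (n + 1), (n.choose k : ℂ) * bernoulliPoly (n - k) x * y ^ k := by
  simp only [bernoulliPoly, add_comm x y, add_pow, mul_sum, sum_mul]
  rw [sum_comm' (t' := range (n + 1)) (s' := fun k => range (n - k + 1))
    (by simp only [mem_range]; omega)]
  refine sum_congr rfl fun j hj => sum_congr rfl fun k hk => ?_
  simp only [mem_range] at hj hk
  have hc : n.choose k * (n - k).choose j = n.choose j * (n - j).choose k := by
    have h₁ := Nat.choose_mul (n := n) (k := j + k) (s := k) (by omega)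
    have h₂ := Nat.choose_mul (n := n) (k := j + k) (s := j) (by omega)
    rw [Nat.add_sub_cancel] at h₁
    rw [Nat.add_sub_cancel_left] at h₂
    rw [← h₁, ← h₂, Nat.choose_symm_add]
  have hc' : (n.choose k : ℂ) * (n - k).choose j = n.choose j * (n - j).choose k := by
    exact_mod_cast hc
  rw [show n - k - j = n - j - k by omega]
  linear_combination (bernoulli k : ℂ) * y ^ j * x ^ (n - j - k) * hc'

theorem one_add_ω_add_sq : 1 + ω + ω ^ 2 = 0 := by
  have h : (Real.sqrt 3 : ℂ) ^ 2 = 3 := by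
    exact_mod_cast Real.sq_sqrt (show (0 : ℝ) ≤ 3 by norm_num)
  rw [ω]
  linear_combination (Complex.I ^ 2 / 4) * h + (3 / 4) * Complex.I_sq

theorem ω_pow_three : ω ^ 3 = 1 := by
  linear_combination (ω - 1) * one_add_ω_add_sq

/-- The alternating sum of `k`-th powers of the sixth roots of unity detects `k ≡ 3 [MOD 6]`. -/
theorem alternating_sum_sixth_roots_pow (k : ℕ) :
    1 - (-1) ^ k + ω ^ k - (1 + ω) ^ k + (ω ^ 2) ^ k - (1 + ω ^ 2) ^ k =
      if k % 6 = 3 then (6 : ℂ) else 0 := by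
  have h := one_add_ω_add_sq
  have h3 := ω_pow_three
  rw [show 1 + ω = -ω ^ 2 by linear_combination h, show 1 + ω ^ 2 = -ω by linear_combination h]
  have period : ∀ z : ℂ, z ^ 6 = 1 → z ^ k = z ^ (k % 6) := fun z hz => pow_eq_pow_mod k hz
  have h6 : ω ^ 6 = 1 := by linear_combination (ω ^ 3 + 1) * h3
  have h12 : (ω ^ 2) ^ 6 = 1 := by linear_combination (ω ^ 6 + 1) * h6
  rw [period (-1) (by norm_num), period ω h6, period (-ω ^ 2) (by rw [← h12]; ring),
    period (ω ^ 2) h12, period (-ω) (by rw [← h6]; ring)]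
  have hk : k % 6 < 6 := Nat.mod_lt _ (by norm_num)
  generalize k % 6 = r at hk
  interval_cases r <;> norm_num
  · linear_combination 2 * h
  · linear_combination (2 * ω ^ 3 + 4) * h3
  · linear_combination 2 * h + (2 * ω ^ 2 + 2 * ω ^ 7 + 2 * ω ^ 4 + 2 * ω) * h3

theorem sum_choose_bernoulliPoly_mod_six (n : ℕ) (hn : 0 < n) (x : ℂ) :
    ∑ k ∈ (Finset.range (n + 1)).filter (fun k => k % 6 = 3),
      (n.choose k : ℂ) * bernoulliPoly (n - k) x
    = (n : ℂ) / 6 *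
        (x ^ (n - 1) + (x - 1) ^ (n - 1) - (x + ω) ^ (n - 1) - (x + ω ^ 2) ^ (n - 1)) := by
  have key : 6 * ∑ k ∈ (range (n + 1)).filter (fun k => k % 6 = 3),
      (n.choose k : ℂ) * bernoulliPoly (n - k) x =
      bernoulliPoly n (x + 1) - bernoulliPoly n (x + -1) + bernoulliPoly n (x + ω)
        - bernoulliPoly n (x + (1 + ω)) + bernoulliPoly n (x + ω ^ 2)
        - bernoulliPoly n (x + (1 + ω ^ 2)) := by
    simp only [bernoulliPoly_add n x, ← sum_sub_distrib, ← sum_add_distrib]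
    rw [sum_filter, mul_sum]
    refine sum_congr rfl fun k _ => ?_
    have h := alternating_sum_sixth_roots_pow k
    rw [one_pow]
    split_ifs at h ⊢ <;>
      linear_combination (-(n.choose k : ℂ) * bernoulliPoly (n - k) x) * h
  have h₀ := bernoulliPoly_add_one n x
  have h₁ := bernoulliPoly_add_one n (x - 1)
  have h₂ := bernoulliPoly_add_one n (x + ω)
  have h₃ := bernoulliPoly_add_one n (x + ω ^ 2)
  rw [sub_add_cancel] at h₁
  rw [add_assoc, add_comm ω] at h₂
  rw [add_assoc, add_comm (ω ^ 2)] at h₃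
  rw [← sub_eq_add_neg] at key
  linear_combination (key + h₀ + h₁ - h₂ - h₃) / 6
end

section
/- For every odd integer n ≥ 3, Σ_{0 ≤ k ≤ n, k ≡ 3 (mod 6)} C(n,k) 3^k B_{n-k} equals (n/3)(1 + 2^{n-1} − 3^{n-1}/2 − V_{n-1}(1,7)) if n ≡ 1 (mod 6), and equals (n/3)(1 + 2^{n-1} + 3^{n-1} − V_{n-1}(1,7)) if n ≢ 1 (mod 6). -/
open Finset

/-- The Lucas sequence `V_n(b,c)`: `V_0 = 2`, `V_1 = b`, `V_{n+2} = b V_{n+1} - c V_n`. -/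
def lucasV (b c : ℚ) : ℕ → ℚ
  | 0 => 2
  | 1 => b
  | n + 2 => b * lucasV b c (n + 1) - c * lucasV b c n

lemma lucasV_eq_pow_add_pow {K : Type*} [Field K] [CharZero K] (b c : ℚ) (x y : K)
    (hb : x + y = b) (hc : x * y = c) (n : ℕ) : (lucasV b c n : K) = x ^ n + y ^ n := by
  induction n using Nat.twoStepInduction with
  | zero => simp [lucasV]; norm_num
  | one => simp [lucasV, hb]
  | more n h₀ h₁ =>
    rw [lucasV]
    push_cast
    rw [h₀, h₁, ← hb, ← hc]
    ring

section BernoulliPolynomial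

variable {A : Type*} [CommRing A] [Algebra ℚ A]

lemma aeval_bernoulli_one_add (n : ℕ) (x : A) :
    Polynomial.aeval (1 + x) (Polynomial.bernoulli n) =
      Polynomial.aeval x (Polynomial.bernoulli n) + n * x ^ (n - 1) := by
  simpa [Polynomial.aeval_comp] using
    congrArg (Polynomial.aeval x) (Polynomial.bernoulli_comp_one_add_X n)

lemma aeval_bernoulli_one_sub (n : ℕ) (x : A) :
    Polynomial.aeval (1 - x) (Polynomial.bernoulli n) =
      (-1) ^ n * Polynomial.aeval x (Polynomial.bernoulli n) := by
  simpa [Polynomial.aeval_comp] using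
    congrArg (Polynomial.aeval x) (Polynomial.bernoulli_comp_one_sub_X n)

lemma aeval_bernoulli_add_natCast (n m : ℕ) (x : A) :
    Polynomial.aeval (x + m) (Polynomial.bernoulli n) =
      Polynomial.aeval x (Polynomial.bernoulli n) +
        n * ∑ j ∈ range m, (x + j) ^ (n - 1) := by
  induction m with
  | zero => simp
  | succ m ih =>
    rw [show x + ((m + 1 : ℕ) : A) = 1 + (x + m) by push_cast; ring,
      aeval_bernoulli_one_add, ih, sum_range_succ]
    ring

end BernoulliPolynomial

lemma aeval_bernoulli_mul {K : Type*} [Field K] [CharZero K] (n : ℕ) (a z : K) :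
    Polynomial.aeval (a * z) (Polynomial.bernoulli n) =
      ∑ k ∈ range (n + 1), (n.choose k : K) * a ^ k * (bernoulli (n - k) : ℚ) * z ^ k := by
  rw [Polynomial.bernoulli_def, map_sum]
  refine sum_congr rfl fun k _ => ?_
  rw [Polynomial.aeval_monomial, eq_ratCast]
  push_cast
  ring

section CubeRootOfUnity

variable {K : Type*} [Field K] {ω : K}

lemma pow_three_of_one_add_self_add_sq (hω : 1 + ω + ω ^ 2 = 0) : ω ^ 3 = 1 := by
  linear_combination (ω - 1) * hω

lemma pow_eq_pow_mod_three (hω : 1 + ω + ω ^ 2 = 0) (k : ℕ) : ω ^ k = ω ^ (k % 3) :=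
  pow_eq_pow_mod k (pow_three_of_one_add_self_add_sq hω)

lemma pow_add_sq_pow (hω : 1 + ω + ω ^ 2 = 0) (k : ℕ) :
    ω ^ k + (ω ^ 2) ^ k = if k % 3 = 0 then 2 else -1 := by
  have h3 := pow_three_of_one_add_self_add_sq hω
  rw [← pow_mul, mul_comm, pow_mul, pow_eq_pow_mod_three hω k]
  have : k % 3 < 3 := Nat.mod_lt _ (by norm_num)
  interval_cases k % 3
  · norm_num
  · norm_num
    linear_combination hω
  · norm_num
    linear_combination hω + ω * h3

variable [CharZero K]

/-- For odd `n` the terms with `3 ∣ k` and `k` even vanish except possibly at `k = n - 1`. -/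
lemma sum_aeval_bernoulli_three_mul (hω : 1 + ω + ω ^ 2 = 0) {n : ℕ} (hodd : Odd n) :
    Polynomial.aeval (3 * 1 : K) (Polynomial.bernoulli n) +
        Polynomial.aeval (3 * ω) (Polynomial.bernoulli n) +
        Polynomial.aeval (3 * ω ^ 2) (Polynomial.bernoulli n) =
      3 * ((∑ k ∈ (range (n + 1)).filter (fun k => k % 6 = 3),
        (n.choose k : ℚ) * 3 ^ k * bernoulli (n - k) : ℚ) : K) -
        if n % 6 = 1 then (3 * n * 3 ^ (n - 1) / 2 : K) else 0 := by
  have key : ∀ k ∈ range (n + 1),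
      (n.choose k : K) * 3 ^ k * (bernoulli (n - k) : ℚ) * (1 + (ω ^ k + (ω ^ 2) ^ k)) =
        3 * (if k % 6 = 3 then (n.choose k : K) * 3 ^ k * (bernoulli (n - k) : ℚ) else 0) -
        if k = n - 1 then (if n % 6 = 1 then (3 * n * 3 ^ (n - 1) / 2 : K) else 0) else 0 := by
    intro k hk
    rw [mem_range] at hk
    obtain ⟨m, rfl⟩ := hodd
    rw [pow_add_sq_pow hω]
    by_cases hk1 : k = 2 * m
    · subst hk1
      have h6 : ¬ (2 * m) % 6 = 3 := by omega
      have hb : bernoulli (2 * m + 1 - 2 * m) = -1 / 2 := by simp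
      have hc : (2 * m + 1).choose (2 * m) = 2 * m + 1 := Nat.choose_succ_self_right _
      rw [hb, hc, if_neg h6]
      by_cases h3 : (2 * m) % 3 = 0
      · have h1 : (2 * m + 1) % 6 = 1 := by omega
        simp [h3, h1]
        ring
      · have h1 : ¬ (2 * m + 1) % 6 = 1 := by omega
        simp [h3, h1]
    · rw [if_neg (show ¬ k = 2 * m + 1 - 1 by omega)]
      by_cases h3 : k % 3 = 0
      · by_cases h6 : k % 6 = 3
        · simp only [h3, h6, if_true]
          ring
        · have hb : bernoulli (2 * m + 1 - k) = 0 :=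
            bernoulli_eq_zero_of_odd (by rw [Nat.odd_iff]; omega) (by omega)
          simp [hb]
      · have h6 : ¬ k % 6 = 3 := by omega
        simp [h3, h6]
  have hsum := sum_congr rfl key
  rw [sum_sub_distrib, ← mul_sum, sum_ite_eq' (range (n + 1)) (n - 1),
    if_pos (mem_range.2 (by omega)), ← sum_filter] at hsum
  push_cast
  rw [← hsum, aeval_bernoulli_mul, aeval_bernoulli_mul, aeval_bernoulli_mul,
    ← sum_add_distrib, ← sum_add_distrib]
  refine sum_congr rfl fun k _ => ?_
  rw [one_pow]
  ring

lemma aeval_bernoulli_three {n : ℕ} (hn : 3 ≤ n) (hodd : Odd n) :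
    Polynomial.aeval (3 * 1 : K) (Polynomial.bernoulli n) = n * (1 + 2 ^ (n - 1)) := by
  have h := aeval_bernoulli_add_natCast n 3 (0 : K)
  have h0 : Polynomial.aeval (0 : K) (Polynomial.bernoulli n) = 0 := by
    have := aeval_bernoulli_mul n (1 : K) 0
    rw [mul_zero] at this
    rw [this, sum_eq_single_of_mem 0 (by simp) (by intro k _ hk; simp [hk])]
    simp [bernoulli_eq_zero_of_odd hodd (by omega)]
  rw [h0] at h
  have hne : n - 1 ≠ 0 := by omega
  simpa [sum_range_succ, hne] using h

lemma aeval_bernoulli_three_mul_add_sq (hω : 1 + ω + ω ^ 2 = 0) {n : ℕ} (hodd : Odd n) :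
    Polynomial.aeval (3 * ω) (Polynomial.bernoulli n) +
        Polynomial.aeval (3 * ω ^ 2) (Polynomial.bernoulli n) =
      -n * (3 ^ (n - 1) * (if (n - 1) % 3 = 0 then 2 else -1) + (lucasV 1 7 (n - 1) : K)) := by
  have h := aeval_bernoulli_add_natCast n 4 (3 * ω)
  have hs := aeval_bernoulli_one_sub n (3 * ω ^ 2)
  rw [show 1 - 3 * ω ^ 2 = 3 * ω + (4 : ℕ) by push_cast; linear_combination -3 * hω, h,
    hodd.neg_one_pow] at hs
  have heven : Even (n - 1) := by
    obtain ⟨m, rfl⟩ := hodd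
    simp
  have hV := lucasV_eq_pow_add_pow 1 7 (3 * ω + 2) (-(3 * ω + 1))
    (by push_cast; ring) (by push_cast; linear_combination -9 * hω) (n - 1)
  rw [heven.neg_pow] at hV
  have h3 : (3 * ω + 3) ^ (n - 1) = 3 ^ (n - 1) * (ω ^ 2) ^ (n - 1) := by
    rw [← mul_pow, ← heven.neg_pow]
    congr 1
    linear_combination -3 * hω
  rw [hV, ← pow_add_sq_pow hω]
  simp only [sum_range_succ, sum_range_zero] at hs
  push_cast at hs
  rw [h3, add_zero, mul_pow] at hs
  linear_combination hs

end CubeRootOfUnity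

lemma exists_one_add_self_add_sq_eq_zero : ∃ ω : ℂ, 1 + ω + ω ^ 2 = 0 := by
  have h := (Complex.isPrimitiveRoot_exp 3 (by norm_num)).geom_sum_eq_zero (by norm_num)
  exact ⟨_, by simpa [sum_range_succ] using h⟩

theorem sum_choose_three_pow_bernoulli_mod_six (n : ℕ) (hn : 3 ≤ n) (hodd : Odd n) :
    ∑ k ∈ (Finset.range (n + 1)).filter (fun k => k % 6 = 3),
      (n.choose k : ℚ) * 3 ^ k * bernoulli (n - k)
    = if n % 6 = 1 then
        (n : ℚ) / 3 * (1 + 2 ^ (n - 1) - 3 ^ (n - 1) / 2 - lucasV 1 7 (n - 1))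
      else
        (n : ℚ) / 3 * (1 + 2 ^ (n - 1) + 3 ^ (n - 1) - lucasV 1 7 (n - 1)) := by
  obtain ⟨ω, hω⟩ := exists_one_add_self_add_sq_eq_zero
  have h := sum_aeval_bernoulli_three_mul hω hodd
  rw [add_assoc, aeval_bernoulli_three hn hodd, aeval_bernoulli_three_mul_add_sq hω hodd] at h
  generalize ∑ k ∈ (Finset.range (n + 1)).filter (fun k => k % 6 = 3),
    (n.choose k : ℚ) * 3 ^ k * bernoulli (n - k) = S at h ⊢
  have hmod : n % 2 = 1 := Nat.odd_iff.1 hodd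
  by_cases h1 : n % 6 = 1
  · have h3 : (n - 1) % 3 = 0 := by omega
    rw [if_pos h1]
    rw [if_pos h1, if_pos h3] at h
    refine Rat.cast_injective (α := ℂ) ?_
    push_cast
    linear_combination -h / 3
  · have h3 : ¬ (n - 1) % 3 = 0 := by omega
    rw [if_neg h1]
    rw [if_neg h1, if_neg h3] at h
    refine Rat.cast_injective (α := ℂ) ?_
    push_cast
    linear_combination -h / 3
end

section
/- (Ramanujan) For every positive even integer n, Σ_{0 ≤ k ≤ n, k ≡ 2 (mod 4)} C(n,k) (−1)^{(k-2)/4} 2^{(n-k)/2} B_{n-k} = (−1)^{⌊(n-2)/4⌋} n/2. -/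
open Finset

/-- The point `(1 + i) / 2` is fixed under `x ↦ 1 - conj x`, so even Bernoulli polynomials take real
values there. -/
lemma im_aeval_bernoulli_one_add_I_div_two {n : ℕ} (hn : Even n) :
    (Polynomial.aeval ((1 + Complex.I) / 2) (Polynomial.bernoulli n)).im = 0 := by
  have h := congr(Polynomial.aeval ((1 + Complex.I) / 2) $(Polynomial.bernoulli_comp_one_sub_X n))
  rw [hn.neg_one_pow, one_mul, Polynomial.aeval_comp] at h
  have hconj : Polynomial.aeval ((1 + Complex.I) / 2) (1 - Polynomial.X : Polynomial ℚ)
      = (Complex.conjAe.restrictScalars ℚ) ((1 + Complex.I) / 2) := by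
    simp [map_ofNat]
    ring
  rw [hconj, Polynomial.aeval_algHom_apply] at h
  exact Complex.conj_eq_iff_im.1 h

lemma one_add_I_div_two_sq : ((1 + Complex.I) / 2) ^ 2 = Complex.I / 2 := by
  linear_combination Complex.I_sq / 4

lemma two_pow_mul_one_add_I_div_two_pow (j l : ℕ) :
    (2 : ℂ) ^ (j + l) * ((1 + Complex.I) / 2) ^ (2 * j) = 2 ^ l * Complex.I ^ j := by
  rw [pow_mul, one_add_I_div_two_sq, div_pow, pow_add]
  field_simp

lemma I_pow_two_mul_add_one (q : ℕ) : Complex.I ^ (2 * q + 1) = (-1) ^ q * Complex.I := by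
  rw [pow_succ, pow_mul, Complex.I_sq]

lemma neg_one_pow_im (q : ℕ) : ((-1 : ℂ) ^ q).im = 0 := by
  rcases neg_one_pow_eq_or ℂ q with h | h <;> simp [h]

lemma neg_one_pow_re (q : ℕ) : ((-1 : ℂ) ^ q).re = (-1) ^ q := by
  rcases q.even_or_odd with h | h <;> simp [h.neg_one_pow]

lemma I_pow_mul_one_add_I_im (m : ℕ) :
    (Complex.I ^ m * (1 + Complex.I)).im = (-1 : ℝ) ^ (m / 2) := by
  obtain ⟨q, rfl | rfl⟩ := m.even_or_odd'
  · simp [pow_mul, neg_one_pow_im, neg_one_pow_re]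
  · rw [I_pow_two_mul_add_one, show (2 * q + 1) / 2 = q by omega]
    simp [neg_one_pow_im, neg_one_pow_re]

lemma two_pow_mul_im_bernoulli_term (m k : ℕ) (hk : k ≤ 2 * (m + 1)) :
    ((2 : ℂ) ^ (m + 1) * ((bernoulli (2 * (m + 1) - k) * (2 * (m + 1)).choose k : ℚ) *
      ((1 + Complex.I) / 2) ^ k)).im =
    (if k % 4 = 2 then
      ((((2 * (m + 1)).choose k : ℚ) * (-1 : ℚ) ^ ((k - 2) / 4) * 2 ^ ((2 * (m + 1) - k) / 2) *
        bernoulli (2 * (m + 1) - k) : ℚ) : ℝ) else 0) -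
    (if k = 2 * m + 1 then (m + 1 : ℝ) * (-1) ^ (m / 2) else 0) := by
  obtain ⟨j, rfl | rfl⟩ := k.even_or_odd'
  · obtain ⟨l, hl⟩ := Nat.exists_eq_add_of_le (show j ≤ m + 1 by omega)
    have hne : 2 * j ≠ 2 * m + 1 := by omega
    rw [if_neg hne, mul_left_comm, hl, two_pow_mul_one_add_I_div_two_pow,
      show 2 * (j + l) - 2 * j = 2 * l by omega, Nat.mul_div_cancel_left l two_pos]
    rw [← Complex.ofReal_ratCast, Complex.im_ofReal_mul,
      show (2 : ℂ) ^ l = ((2 ^ l : ℝ) : ℂ) by push_cast; rfl, Complex.im_ofReal_mul]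
    obtain ⟨q, rfl | rfl⟩ := j.even_or_odd'
    · rw [if_neg (by omega), pow_mul, Complex.I_sq, neg_one_pow_im]
      simp
    · rw [if_pos (by omega), I_pow_two_mul_add_one, show (2 * (2 * q + 1) - 2) / 4 = q by omega]
      simp [neg_one_pow_re]
      ring
  · rcases eq_or_ne j m with rfl | hj
    · have h4 : ¬ (2 * j + 1) % 4 = 2 := by omega
      have hx : (2 : ℂ) ^ (j + 1) * ((1 + Complex.I) / 2) ^ (2 * j + 1)
          = Complex.I ^ j * (1 + Complex.I) := by
        have := two_pow_mul_one_add_I_div_two_pow j 1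
        rw [pow_succ _ (2 * j), ← mul_assoc, this]
        ring
      rw [if_neg h4, if_pos rfl, mul_left_comm, hx,
        show 2 * (j + 1) - (2 * j + 1) = 1 by omega, show 2 * (j + 1) = 2 * j + 1 + 1 by ring,
        Nat.choose_succ_self_right, bernoulli_one, ← Complex.ofReal_ratCast,
        Complex.im_ofReal_mul, I_pow_mul_one_add_I_im]
      push_cast
      ring
    · have h4 : ¬ (2 * j + 1) % 4 = 2 := by omega
      rw [bernoulli_eq_zero_of_odd ⟨m - j, by omega⟩ (by omega), if_neg h4,
        if_neg (by omega)]
      simp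

theorem ramanujan_sum_bernoulli_mod_four (n : ℕ) (hn : 0 < n) (heven : Even n) :
    ∑ k ∈ (Finset.range (n + 1)).filter (fun k => k % 4 = 2),
      (n.choose k : ℚ) * (-1 : ℚ) ^ ((k - 2) / 4) * 2 ^ ((n - k) / 2) * bernoulli (n - k)
    = (-1 : ℚ) ^ ((n - 2) / 4) * (n : ℚ) / 2 := by
  have h := im_aeval_bernoulli_one_add_I_div_two heven
  obtain ⟨m, rfl⟩ : ∃ m, n = 2 * (m + 1) := by
    obtain ⟨r, rfl⟩ := heven
    exact ⟨r - 1, by omega⟩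
  have h2 : ((2 : ℂ) ^ (m + 1) * Polynomial.aeval ((1 + Complex.I) / 2)
      (Polynomial.bernoulli (2 * (m + 1)))).im = 0 := by
    have : (2 : ℂ) ^ (m + 1) = ((2 ^ (m + 1) : ℝ) : ℂ) := by push_cast; rfl
    rw [this, Complex.im_ofReal_mul, h, mul_zero]
  simp only [Polynomial.bernoulli_def, map_sum, Polynomial.aeval_monomial, mul_sum,
    Complex.im_sum, eq_ratCast] at h2
  rw [sum_congr rfl fun k hk => two_pow_mul_im_bernoulli_term m k (mem_range_succ_iff.1 hk),
    sum_sub_distrib, ← sum_filter, sum_ite_eq', if_pos (by simp), sub_eq_zero,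
    ← Rat.cast_sum] at h2
  rw [show (2 * (m + 1) - 2) / 4 = m / 2 by omega]
  apply Rat.cast_injective (α := ℝ)
  rw [h2]
  push_cast
  ring
end

section
/- For every positive even integer n, Σ_{0 ≤ k ≤ n, k ≡ 2 (mod 4)} C(n,k) (−1)^{(k-2)/4} 2^{3k/2} B_{n-k} = (n/2) ( (−1)^{⌊(n-2)/4⌋} 2^{3n/2−2} − (−1)^{n/2} 2^{n-1} + 4 U_{n-1}(2,5) ). -/
open Finset

/-- The Lucas sequence `U_n(b,c)`: `U_0 = 0`, `U_1 = 1`, `U_{n+2} = b U_{n+1} - c U_n`. -/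
def lucasU (b c : ℚ) : ℕ → ℚ
  | 0 => 0
  | 1 => 1
  | n + 2 => b * lucasU b c (n + 1) - c * lucasU b c n

lemma bernoulli_aeval_add_one (n : ℕ) (z : ℂ) :
    Polynomial.aeval (z + 1) (Polynomial.bernoulli n) =
      Polynomial.aeval z (Polynomial.bernoulli n) + n * z ^ (n - 1) := by
  have h := congrArg (Polynomial.aeval z) (Polynomial.bernoulli_comp_one_add_X n)
  rw [Polynomial.aeval_comp] at h
  simpa [add_comm, nsmul_eq_mul] using h

lemma bernoulli_aeval_add_four (n : ℕ) (z : ℂ) :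
    Polynomial.aeval (z + 4) (Polynomial.bernoulli n) =
      Polynomial.aeval z (Polynomial.bernoulli n) +
        n * (z ^ (n - 1) + (z + 1) ^ (n - 1) + (z + 2) ^ (n - 1) + (z + 3) ^ (n - 1)) := by
  have h0 := bernoulli_aeval_add_one n z
  have h1 := bernoulli_aeval_add_one n (z + 1)
  have h2 := bernoulli_aeval_add_one n (z + 2)
  have h3 := bernoulli_aeval_add_one n (z + 3)
  rw [show z + 1 + 1 = z + 2 by ring] at h1
  rw [show z + 2 + 1 = z + 3 by ring] at h2
  rw [show z + 3 + 1 = z + 4 by ring] at h3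
  rw [h3, h2, h1, h0]
  ring

lemma bernoulli_aeval_eq_sum (n : ℕ) (z : ℂ) :
    Polynomial.aeval z (Polynomial.bernoulli n) =
      ∑ k ∈ range (n + 1), (bernoulli (n - k) : ℂ) * n.choose k * z ^ k := by
  simp [Polynomial.bernoulli_def, map_sum, Polynomial.aeval_monomial]

lemma two_mul_I_add_one_pow_sub (m : ℕ) :
    (1 + 2 * Complex.I) ^ m - (1 - 2 * Complex.I) ^ m =
      4 * Complex.I * ((lucasU 2 5 m : ℚ) : ℂ) := by
  induction m using Nat.twoStepInduction with
  | zero => simp [lucasU]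
  | one => simp [lucasU]; ring
  | more m h0 h1 =>
    have hI := Complex.I_sq
    simp only [lucasU]
    push_cast
    linear_combination 2 * h1 - 5 * h0 +
      (4 * (1 + 2 * Complex.I) ^ m - 4 * (1 - 2 * Complex.I) ^ m) * hI

lemma sum_I_pow_mul_eq_ite (k : ℕ) :
    (2 + 2 * Complex.I) ^ k - (-2 + 2 * Complex.I) ^ k + (-2 - 2 * Complex.I) ^ k
        - (2 - 2 * Complex.I) ^ k =
      if k % 4 = 2 then 4 * Complex.I * ((-1) ^ ((k - 2) / 4) * 2 ^ (3 * (k / 2))) else 0 := by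
  have hI := Complex.I_sq
  have h1 : (2 + 2 * Complex.I) ^ 4 = -64 := by
    linear_combination (96 + 64 * Complex.I + 16 * (Complex.I ^ 2 - 1)) * hI
  have h2 : (-2 + 2 * Complex.I) ^ 4 = -64 := by
    linear_combination (96 - 64 * Complex.I + 16 * (Complex.I ^ 2 - 1)) * hI
  have h3 : (-2 - 2 * Complex.I) ^ 4 = -64 := by
    linear_combination (96 + 64 * Complex.I + 16 * (Complex.I ^ 2 - 1)) * hI
  have h4 : (2 - 2 * Complex.I) ^ 4 = -64 := by
    linear_combination (96 - 64 * Complex.I + 16 * (Complex.I ^ 2 - 1)) * hI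
  obtain ⟨q, r, hr, rfl⟩ : ∃ q r, r < 4 ∧ k = 4 * q + r :=
    ⟨k / 4, k % 4, Nat.mod_lt _ (by norm_num), (Nat.div_add_mod k 4).symm⟩
  simp only [pow_add _ (4 * q) r, pow_mul _ 4 q, h1, h2, h3, h4]
  interval_cases r
  · rw [if_neg (by omega)]; ring
  · rw [if_neg (by omega)]; ring
  · rw [if_pos (by omega), show (4 * q + 2 - 2) / 4 = q by omega,
      show 3 * ((4 * q + 2) / 2) = 6 * q + 3 by omega, pow_add _ (6 * q), pow_mul _ 6 q,
      show (-64 : ℂ) = (-1) * 2 ^ 6 by norm_num, mul_pow]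
    ring
  · rw [if_neg (by omega)]; ring

lemma neg_two_add_two_I_pow_sub (t : ℕ) :
    (-2 + 2 * Complex.I) ^ (2 * t + 1) - (-2 - 2 * Complex.I) ^ (2 * t + 1) =
      2 * Complex.I * ((-1) ^ (t / 2) * 2 ^ (3 * t + 1)) := by
  have hI := Complex.I_sq
  have h1 : (-2 + 2 * Complex.I) ^ 2 = -8 * Complex.I := by linear_combination 4 * hI
  have h2 : (-2 - 2 * Complex.I) ^ 2 = 8 * Complex.I := by linear_combination 4 * hI
  rw [pow_succ _ (2 * t), pow_succ _ (2 * t), pow_mul, pow_mul, h1, h2]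
  obtain ⟨s, rfl | rfl⟩ := Nat.even_or_odd' t
  · have e1 : (-8 * Complex.I) ^ 2 = -1 * 2 ^ 6 := by linear_combination 64 * hI
    have e2 : (8 * Complex.I) ^ 2 = -1 * 2 ^ 6 := by linear_combination 64 * hI
    rw [pow_mul, pow_mul, e1, e2, show 2 * s / 2 = s by omega,
      show 3 * (2 * s) + 1 = 6 * s + 1 by omega, pow_succ _ (6 * s), pow_mul _ 6 s, mul_pow]
    ring
  · have e1 : (-8 * Complex.I) ^ 2 = -1 * 2 ^ 6 := by linear_combination 64 * hI
    have e2 : (8 * Complex.I) ^ 2 = -1 * 2 ^ 6 := by linear_combination 64 * hI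
    rw [pow_succ _ (2 * s), pow_succ _ (2 * s), pow_mul, pow_mul, e1, e2, show (2 * s + 1) / 2 = s by omega,
      show 3 * (2 * s + 1) + 1 = 6 * s + 4 by omega, pow_add _ (6 * s), pow_mul _ 6 s, mul_pow]
    ring

lemma two_I_pow_odd (t : ℕ) :
    (2 * Complex.I) ^ (2 * t + 1) = Complex.I * ((-1) ^ t * 2 ^ (2 * t + 1)) := by
  rw [mul_pow, pow_succ Complex.I, pow_mul Complex.I, Complex.I_sq]
  ring

theorem sum_choose_eight_pow_bernoulli_mod_four (n : ℕ) (hn : 0 < n) (heven : Even n) :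
    ∑ k ∈ (Finset.range (n + 1)).filter (fun k => k % 4 = 2),
      (n.choose k : ℚ) * (-1 : ℚ) ^ ((k - 2) / 4) * 2 ^ (3 * (k / 2)) * bernoulli (n - k)
    = (n : ℚ) / 2 *
        ((-1 : ℚ) ^ ((n - 2) / 4) * 2 ^ (3 * (n / 2) - 2) - (-1 : ℚ) ^ (n / 2) * 2 ^ (n - 1)
          + 4 * lucasU 2 5 (n - 1)) := by
  have hsum : 4 * Complex.I * ((∑ k ∈ (Finset.range (n + 1)).filter (fun k => k % 4 = 2),
      (n.choose k : ℚ) * (-1 : ℚ) ^ ((k - 2) / 4) * 2 ^ (3 * (k / 2)) * bernoulli (n - k) : ℚ) : ℂ)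
      = Polynomial.aeval (2 + 2 * Complex.I) (Polynomial.bernoulli n)
        - Polynomial.aeval (-2 + 2 * Complex.I) (Polynomial.bernoulli n)
        + Polynomial.aeval (-2 - 2 * Complex.I) (Polynomial.bernoulli n)
        - Polynomial.aeval (2 - 2 * Complex.I) (Polynomial.bernoulli n) := by
    simp only [bernoulli_aeval_eq_sum, ← Finset.sum_sub_distrib, ← Finset.sum_add_distrib]
    push_cast
    rw [Finset.sum_filter, Finset.mul_sum]
    refine Finset.sum_congr rfl fun k _ => ?_
    have h := sum_I_pow_mul_eq_ite k
    split_ifs at h ⊢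
    · linear_combination -((bernoulli (n - k) : ℂ) * n.choose k) * h
    · linear_combination -((bernoulli (n - k) : ℂ) * n.choose k) * h
  have ha := bernoulli_aeval_add_four n (-2 + 2 * Complex.I)
  have hb := bernoulli_aeval_add_four n (-2 - 2 * Complex.I)
  rw [show -2 + 2 * Complex.I + 4 = 2 + 2 * Complex.I by ring,
    show -2 + 2 * Complex.I + 1 = -(1 - 2 * Complex.I) by ring,
    show -2 + 2 * Complex.I + 2 = 2 * Complex.I by ring,
    show -2 + 2 * Complex.I + 3 = 1 + 2 * Complex.I by ring] at ha
  rw [show -2 - 2 * Complex.I + 4 = 2 - 2 * Complex.I by ring,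
    show -2 - 2 * Complex.I + 1 = -(1 + 2 * Complex.I) by ring,
    show -2 - 2 * Complex.I + 2 = -(2 * Complex.I) by ring,
    show -2 - 2 * Complex.I + 3 = 1 - 2 * Complex.I by ring] at hb
  obtain ⟨t, rfl⟩ : ∃ t, n = 2 * t + 2 := by
    obtain ⟨r, rfl⟩ := heven
    exact ⟨r - 1, by omega⟩
  have hodd : Odd (2 * t + 1) := ⟨t, rfl⟩
  rw [show 2 * t + 2 - 1 = 2 * t + 1 by omega] at ha hb ⊢
  rw [hodd.neg_pow] at ha
  rw [hodd.neg_pow, hodd.neg_pow] at hb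
  have h1 := neg_two_add_two_I_pow_sub t
  have h2 := two_I_pow_odd t
  have h3 := two_mul_I_add_one_pow_sub (2 * t + 1)
  rw [← Rat.cast_inj (α := ℂ)]
  refine mul_left_cancel₀ (a := 4 * Complex.I) (by simp) (hsum.trans ?_)
  rw [show (2 * t + 2 - 2) / 4 = t / 2 by omega, show (2 * t + 2) / 2 = t + 1 by omega,
    show 3 * (t + 1) - 2 = 3 * t + 1 by omega]
  push_cast at ha hb ⊢
  linear_combination ha - hb + (2 * (t : ℂ) + 2) * (h1 + 2 * h2 + 2 * h3)
end

section
/- For every positive even integer n, Σ_{1 ≤ k ≤ n, 4 | k} C(n,k) ( (−4)^{k/4} − 2 ) B_{n-k} = (n/2) ( (−1)^{⌊n/4⌋} 2^{n/2−1} − 1 ). -/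
open Finset

/-- The fourth roots of unity filter the multiples of `4` among the exponents. -/
theorem sum_fourth_root_mul_pow (z : ℂ) (k : ℕ) :
    z ^ k + (Complex.I * z) ^ k + (-z) ^ k + (-(Complex.I * z)) ^ k =
      if 4 ∣ k then 4 * (z ^ 4) ^ (k / 4) else 0 := by
  obtain ⟨j, r, hr, rfl⟩ : ∃ j r, r < 4 ∧ k = 4 * j + r :=
    ⟨k / 4, k % 4, Nat.mod_lt _ (by norm_num), (Nat.div_add_mod k 4).symm⟩
  have hI : (Complex.I * z) ^ 4 = z ^ 4 := by rw [mul_pow, Complex.I_pow_four, one_mul]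
  have hn : (-z) ^ 4 = z ^ 4 := by ring
  have hnI : (-(Complex.I * z)) ^ 4 = z ^ 4 := by rw [← hI]; ring
  simp only [pow_add, pow_mul, hI, hn, hnI]
  interval_cases r
  · simp only [add_zero, dvd_mul_right, if_true, pow_zero, Nat.mul_div_cancel_left j four_pos]
    ring
  · rw [if_neg (by omega)]
    ring
  · rw [if_neg (by omega)]
    linear_combination (2 * (z ^ 4) ^ j * z ^ 2) * Complex.I_sq
  · rw [if_neg (by omega)]
    ring

theorem aeval_bernoulli_eq_sum {A : Type*} [CommRing A] [Algebra ℚ A] (n : ℕ) (z : A) :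
    Polynomial.aeval z (Polynomial.bernoulli n) =
      ∑ k ∈ range (n + 1), algebraMap ℚ A (bernoulli (n - k) * n.choose k) * z ^ k := by
  rw [Polynomial.bernoulli_def, map_sum]
  exact sum_congr rfl fun k _ => Polynomial.aeval_monomial z

theorem aeval_one_add_bernoulli {A : Type*} [CommRing A] [Algebra ℚ A] (n : ℕ) (z : A) :
    Polynomial.aeval (1 + z) (Polynomial.bernoulli n) =
      Polynomial.aeval z (Polynomial.bernoulli n) + n * z ^ (n - 1) := by
  simpa [Polynomial.aeval_comp] using
    congr(Polynomial.aeval z $(Polynomial.bernoulli_comp_one_add_X n))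

/-- Summing a Bernoulli polynomial over the four associates of `z` isolates the
terms whose degree is a multiple of `4`. -/
theorem sum_aeval_fourth_root_mul_bernoulli (n : ℕ) (z : ℂ) :
    Polynomial.aeval z (Polynomial.bernoulli n)
      + Polynomial.aeval (Complex.I * z) (Polynomial.bernoulli n)
      + Polynomial.aeval (-z) (Polynomial.bernoulli n)
      + Polynomial.aeval (-(Complex.I * z)) (Polynomial.bernoulli n) =
    4 * ∑ k ∈ (range (n + 1)).filter (fun k => 4 ∣ k),
      (n.choose k : ℂ) * (z ^ 4) ^ (k / 4) * (bernoulli (n - k) : ℂ) := by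
  simp only [aeval_bernoulli_eq_sum, ← sum_add_distrib, ← mul_add, sum_fourth_root_mul_pow,
    sum_filter, mul_sum]
  refine sum_congr rfl fun k _ => ?_
  split_ifs
  · simp only [eq_ratCast, Rat.cast_mul, Rat.cast_natCast]
    ring
  · simp

theorem one_add_I_pow_four : (1 + Complex.I) ^ 4 = -4 := by
  linear_combination (Complex.I ^ 2 + 4 * Complex.I + 5) * Complex.I_sq

theorem one_sub_I_pow_four : (1 - Complex.I) ^ 4 = -4 := by
  linear_combination (Complex.I ^ 2 - 4 * Complex.I + 5) * Complex.I_sq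

theorem one_add_I_pow_add_one_sub_I_pow (m : ℕ) :
    (1 + Complex.I) ^ (2 * m + 1) + (1 - Complex.I) ^ (2 * m + 1) =
      2 * ((-1) ^ ((m + 1) / 2) * 2 ^ m) := by
  have h4 : (2 : ℂ) ^ 2 = 4 := by norm_num
  obtain ⟨j, rfl | rfl⟩ := Nat.even_or_odd' m
  · rw [← mul_assoc, show (2 * j + 1) / 2 = j by omega]
    simp only [pow_succ _ (2 * 2 * j), pow_mul _ 2 j, pow_mul _ (2 * 2) j,
      Nat.reduceMul, one_add_I_pow_four, one_sub_I_pow_four, h4, ← mul_pow]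
    norm_num
    ring
  · rw [show 2 * (2 * j + 1) + 1 = 4 * j + 3 by ring, show (2 * j + 1 + 1) / 2 = j + 1 by omega]
    simp only [pow_add _ (4 * j), pow_mul _ 4 j, one_add_I_pow_four, one_sub_I_pow_four,
      pow_succ _ (2 * j), pow_succ _ j, pow_mul _ 2 j, h4]
    rw [show (-4 : ℂ) = (-1) * 4 by norm_num, mul_pow]
    linear_combination (6 * (-1) ^ j * 4 ^ j) * Complex.I_sq

theorem sum_choose_neg_four_pow_bernoulli (n : ℕ) (hn : 0 < n) (heven : Even n) :
    ∑ k ∈ (Finset.Icc 1 n).filter (fun k => 4 ∣ k),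
      (n.choose k : ℚ) * ((-4 : ℚ) ^ (k / 4) - 2) * bernoulli (n - k)
    = (n : ℚ) / 2 * ((-1 : ℚ) ^ (n / 4) * 2 ^ (n / 2 - 1) - 1) := by
  obtain ⟨m, rfl⟩ : ∃ m, n = 2 * m + 2 := by
    obtain ⟨c, rfl⟩ := heven
    exact ⟨c - 1, by omega⟩
  have hodd : Odd (2 * m + 1) := odd_two_mul_add_one m
  have hsplit : (range (2 * m + 2 + 1)).filter (fun k => 4 ∣ k) =
      insert 0 ((Icc 1 (2 * m + 2)).filter (fun k => 4 ∣ k)) := by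
    ext k
    simp only [mem_filter, mem_range, mem_insert, mem_Icc]
    omega
  rw [show (2 * m + 2) / 4 = (m + 1) / 2 by omega, show (2 * m + 2) / 2 - 1 = m by omega]
  apply Rat.cast_injective (α := ℂ)
  have hroots := sum_aeval_fourth_root_mul_bernoulli (2 * m + 2) (1 + Complex.I)
  have hunits := sum_aeval_fourth_root_mul_bernoulli (2 * m + 2) 1
  rw [show Complex.I * (1 + Complex.I) = -(1 - Complex.I) by
    linear_combination Complex.I_sq, neg_neg, one_add_I_pow_four] at hroots
  rw [mul_one, one_pow] at hunits
  rw [hsplit, sum_insert (by simp)] at hroots hunits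
  have shift := aeval_one_add_bernoulli (A := ℂ) (2 * m + 2)
  have h₁ := shift Complex.I
  have h₂ := shift (-Complex.I)
  have h₃ := shift (-(1 - Complex.I))
  have h₄ := shift (-(1 + Complex.I))
  have h₅ := shift 0
  have h₆ := shift (-1)
  have hzero : Polynomial.aeval (0 : ℂ) (Polynomial.bernoulli (2 * m + 2)) =
      (bernoulli (2 * m + 2) : ℂ) := by
    rw [← map_zero (algebraMap ℚ ℂ), Polynomial.aeval_algebraMap_apply,
      Polynomial.coe_aeval_eq_eval, Polynomial.bernoulli_eval_zero, eq_ratCast]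
  rw [show (2 * m + 2 - 1) = 2 * m + 1 by omega] at h₁ h₂ h₃ h₄ h₅ h₆
  rw [hodd.neg_pow] at h₂ h₃ h₄ h₆
  rw [← sub_eq_add_neg] at h₂
  rw [show 1 + -(1 - Complex.I) = Complex.I by ring] at h₃
  rw [show 1 + -(1 + Complex.I) = -Complex.I by ring] at h₄
  rw [add_zero, zero_pow (by omega), hzero] at h₅
  rw [add_neg_cancel, one_pow, hzero] at h₆
  have hpow := one_add_I_pow_add_one_sub_I_pow m
  simp only [Nat.choose_zero_right, Nat.zero_div, pow_zero, one_pow, Nat.sub_zero,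
    Nat.cast_one, mul_one, one_mul] at hroots hunits
  push_cast at *
  simp only [mul_sub, sub_mul, sum_sub_distrib, mul_right_comm _ (2 : ℂ), ← sum_mul]
  linear_combination (-1 / 4) * hroots + (1 / 2) * hunits + (1 / 4) * (h₁ + h₂ - h₃ - h₄)
    - (1 / 2) * (h₅ - h₆) + ((2 * m + 2) / 4) * hpow
end

section
/- For every positive integer n and every complex number x, Σ_{0 ≤ k ≤ n, 4 | k} C(n,k) (−1)^{k/4} 2^{−k/2} E_{n-k}(x) = (1/2) { (x − 1/2 + i/2)^n + (x − 1/2 − i/2)^n }. -/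
open Finset

open Polynomial in
/-- The umbral functional sending `X ^ r` to `e r`. -/
noncomputable def umbralFunctional (e : ℕ → ℂ) : ℂ[X] →ₗ[ℂ] ℂ :=
  Polynomial.lsum fun r => e r • LinearMap.id

open Polynomial in
theorem umbralFunctional_X_pow (e : ℕ → ℂ) (r : ℕ) : umbralFunctional e (X ^ r) = e r := by
  simp [umbralFunctional, Polynomial.lsum_apply, ← Polynomial.monomial_one_right_eq_X_pow,
    Polynomial.sum_monomial_index]

open Polynomial in
theorem umbralFunctional_X_add_C_pow (e : ℕ → ℂ) (a : ℂ) (n : ℕ) :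
    umbralFunctional e ((X + C a) ^ n) =
      ∑ k ∈ Finset.range (n + 1), (n.choose k : ℂ) * a ^ k * e (n - k) := by
  rw [add_comm, add_pow, map_sum]
  refine Finset.sum_congr rfl fun k _ => ?_
  have h : (C a ^ k * X ^ (n - k) * (n.choose k : ℂ[X])) =
      ((n.choose k : ℂ) * a ^ k) • X ^ (n - k) := by
    rw [Polynomial.smul_eq_C_mul, C_mul, C_pow, C_eq_natCast]
    ring
  rw [h, map_smul, umbralFunctional_X_pow, smul_eq_mul]

open Polynomial in
theorem umbralFunctional_add_comp_X_add_one (e : ℕ → ℂ) (x : ℂ)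
    (he : ∀ n, e n + ∑ r ∈ Finset.range (n + 1), (n.choose r : ℂ) * e r = 2 * x ^ n)
    (p : ℂ[X]) :
    umbralFunctional e p + umbralFunctional e (p.comp (X + 1)) = 2 * p.eval x := by
  induction p using Polynomial.induction_on' with
  | add p q hp hq =>
    rw [add_comp, map_add, map_add, eval_add]
    linear_combination hp + hq
  | monomial n c =>
    have h : umbralFunctional e ((X + 1) ^ n) =
        ∑ r ∈ Finset.range (n + 1), (n.choose r : ℂ) * e r := by
      rw [← C_1, umbralFunctional_X_add_C_pow, ← Finset.sum_range_reflect]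
      refine Finset.sum_congr rfl fun k hk => ?_
      have hk : k ≤ n := Nat.lt_succ_iff.mp (Finset.mem_range.mp hk)
      rw [show n + 1 - 1 - k = n - k by omega, Nat.choose_symm hk, Nat.sub_sub_self hk]
      simp
    rw [← C_mul_X_pow_eq_monomial, ← smul_eq_C_mul, smul_comp, X_pow_comp, map_smul, map_smul, h,
      umbralFunctional_X_pow, eval_smul, eval_pow, eval_X, smul_eq_mul, smul_eq_mul, smul_eq_mul]
    linear_combination c * he n

theorem sum_fourth_roots_neg_quarter_pow (k : ℕ) :
    (1 / 2 + Complex.I / 2) ^ k + (-1 / 2 + Complex.I / 2) ^ k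
      + (1 / 2 - Complex.I / 2) ^ k + (-1 / 2 - Complex.I / 2) ^ k =
    if 4 ∣ k then 4 * ((-1 : ℂ) ^ (k / 4) * (2 : ℂ) ^ (-((k : ℤ) / 2))) else 0 := by
  have hI := Complex.I_sq
  have h1 : (1 / 2 + Complex.I / 2) ^ 4 = -1 / 4 := by grind
  have h2 : (-1 / 2 + Complex.I / 2) ^ 4 = -1 / 4 := by grind
  have h3 : (1 / 2 - Complex.I / 2) ^ 4 = -1 / 4 := by grind
  have h4 : (-1 / 2 - Complex.I / 2) ^ 4 = -1 / 4 := by grind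
  obtain ⟨m, j, hj, rfl⟩ : ∃ m j, j < 4 ∧ k = 4 * m + j :=
    ⟨k / 4, k % 4, Nat.mod_lt _ (by norm_num), (Nat.div_add_mod k 4).symm⟩
  simp only [pow_add, pow_mul, h1, h2, h3, h4]
  interval_cases j
  · have hdiv : ((4 * m + 0 : ℕ) : ℤ) / 2 = ((2 * m : ℕ) : ℤ) := by omega
    rw [if_pos (by omega), hdiv, show (4 * m + 0) / 4 = m by omega, zpow_neg, zpow_natCast,
      pow_mul, ← inv_pow, ← mul_pow]
    norm_num
    ring
  all_goals
    rw [if_neg (by omega)]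
    grind

theorem sum_choose_euler_poly_div_four (E : ℕ → ℂ → ℂ)
    (hE : ∀ n x, E n x + ∑ r ∈ Finset.range (n + 1), (n.choose r : ℂ) * E r x = 2 * x ^ n)
    (n : ℕ) (hn : 0 < n) (x : ℂ) :
    ∑ k ∈ (Finset.range (n + 1)).filter (fun k => 4 ∣ k),
      (n.choose k : ℂ) * (-1 : ℂ) ^ (k / 4) * (2 : ℂ) ^ (-((k : ℤ) / 2)) * E (n - k) x
    = 1 / 2 *
        ((x - 1 / 2 + Complex.I / 2) ^ n + (x - 1 / 2 - Complex.I / 2) ^ n) := by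
  have key (a : ℂ) :
      ∑ k ∈ Finset.range (n + 1), (n.choose k : ℂ) * a ^ k * E (n - k) x +
        ∑ k ∈ Finset.range (n + 1), (n.choose k : ℂ) * (a + 1) ^ k * E (n - k) x =
      2 * (x + a) ^ n := by
    have h := umbralFunctional_add_comp_X_add_one (fun r => E r x) x (fun m => hE m x)
      ((Polynomial.X + Polynomial.C a) ^ n)
    have hc : ((Polynomial.X + Polynomial.C a) ^ n).comp (Polynomial.X + 1) =
        (Polynomial.X + Polynomial.C (a + 1)) ^ n := by
      simp only [Polynomial.pow_comp, Polynomial.add_comp, Polynomial.X_comp, Polynomial.C_comp,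
        Polynomial.C_add, Polynomial.C_1]
      ring
    rw [hc, umbralFunctional_X_add_C_pow, umbralFunctional_X_add_C_pow] at h
    simpa using h
  have hp := key (-1 / 2 + Complex.I / 2)
  have hm := key (-1 / 2 - Complex.I / 2)
  rw [show -1 / 2 + Complex.I / 2 + 1 = 1 / 2 + Complex.I / 2 by ring,
    show x + (-1 / 2 + Complex.I / 2) = x - 1 / 2 + Complex.I / 2 by ring] at hp
  rw [show -1 / 2 - Complex.I / 2 + 1 = 1 / 2 - Complex.I / 2 by ring,
    show x + (-1 / 2 - Complex.I / 2) = x - 1 / 2 - Complex.I / 2 by ring] at hm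
  suffices h : 4 * ∑ k ∈ (Finset.range (n + 1)).filter (fun k => 4 ∣ k),
      (n.choose k : ℂ) * (-1 : ℂ) ^ (k / 4) * (2 : ℂ) ^ (-((k : ℤ) / 2)) * E (n - k) x =
      2 * (x - 1 / 2 + Complex.I / 2) ^ n + 2 * (x - 1 / 2 - Complex.I / 2) ^ n by
    linear_combination h / 4
  rw [← hp, ← hm, Finset.sum_filter, Finset.mul_sum, ← Finset.sum_add_distrib,
    ← Finset.sum_add_distrib, ← Finset.sum_add_distrib]
  refine Finset.sum_congr rfl fun k _ => ?_
  have hk := sum_fourth_roots_neg_quarter_pow k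
  split_ifs at hk ⊢ <;> linear_combination -(n.choose k : ℂ) * E (n - k) x * hk
end

section
/- (Lehmer) For every positive even integer n, Σ_{0 ≤ k ≤ n, 4 | k} C(n,k) (−4)^{k/4} E_{n-k} = (−1)^{n/2}. -/
open Finset

/-- The exponential generating function `∑ aₙ Xⁿ / n!` of a complex sequence. -/
noncomputable def egf (a : ℕ → ℂ) : PowerSeries ℂ :=
  PowerSeries.mk fun n => a n / (n.factorial : ℂ)

theorem coeff_egf (a : ℕ → ℂ) (n : ℕ) :
    PowerSeries.coeff n (egf a) = a n / (n.factorial : ℂ) :=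
  PowerSeries.coeff_mk _ _

theorem egf_mul (a b : ℕ → ℂ) :
    egf a * egf b = egf fun n => ∑ k ∈ range (n + 1), (n.choose k : ℂ) * a k * b (n - k) := by
  ext n
  rw [PowerSeries.coeff_mul, coeff_egf,
    Finset.Nat.sum_antidiagonal_eq_sum_range_succ_mk, Finset.sum_div]
  refine Finset.sum_congr rfl fun k hk => ?_
  have hkn : k ≤ n := Nat.lt_succ_iff.mp (mem_range.mp hk)
  have h1 : (n.factorial : ℂ) ≠ 0 := by exact_mod_cast n.factorial_ne_zero
  have h2 : (k.factorial : ℂ) ≠ 0 := by exact_mod_cast k.factorial_ne_zero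
  have h3 : ((n - k).factorial : ℂ) ≠ 0 := by exact_mod_cast (n - k).factorial_ne_zero
  rw [coeff_egf, coeff_egf, Nat.cast_choose ℂ hkn]
  field_simp

theorem egf_add (a b : ℕ → ℂ) : egf a + egf b = egf fun n => a n + b n := by
  ext n
  simp only [map_add, coeff_egf, add_div]

theorem egf_pow_mul_egf_pow (x y : ℂ) :
    egf (fun n => x ^ n) * egf (fun n => y ^ n) = egf fun n => (x + y) ^ n := by
  rw [egf_mul]
  congr 1
  funext n
  rw [add_pow]
  exact Finset.sum_congr rfl fun k _ => by ring

theorem egf_zero_pow : egf (fun n => (0 : ℂ) ^ n) = 1 := by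
  ext n
  rw [coeff_egf, PowerSeries.coeff_one]
  rcases n with _ | n <;> simp

theorem sum_pow_fourth_roots_neg_four (k : ℕ) :
    (1 + Complex.I) ^ k + (1 + -Complex.I) ^ k + (-1 + Complex.I) ^ k + (-1 + -Complex.I) ^ k
      = 4 * if 4 ∣ k then (-4 : ℂ) ^ (k / 4) else 0 := by
  have hI : Complex.I ^ 2 = -1 := Complex.I_sq
  have h4 (z : ℂ) (hz : z ^ 4 = -4) : z ^ k = (-4) ^ (k / 4) * z ^ (k % 4) := by
    conv_lhs => rw [← Nat.div_add_mod k 4, pow_add, pow_mul, hz]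
  rw [h4 (1 + Complex.I) (by grind), h4 (1 + -Complex.I) (by grind),
    h4 (-1 + Complex.I) (by grind), h4 (-1 + -Complex.I) (by grind)]
  have hk : k % 4 < 4 := Nat.mod_lt _ (by norm_num)
  simp only [Nat.dvd_iff_mod_eq_zero]
  generalize k % 4 = r at hk ⊢
  interval_cases r
  · simp only [pow_zero, if_true]
    ring
  all_goals
    simp only [OfNat.ofNat_ne_zero, one_ne_zero, if_false]
    grind

/-- The numbers `2ⁿ Eₙ(1/2)` have exponential generating function `1 / cosh`. -/
theorem egf_euler_mul (E : ℕ → ℂ → ℂ)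
    (hE : ∀ n x, E n x + ∑ r ∈ Finset.range (n + 1), (n.choose r : ℂ) * E r x = 2 * x ^ n) :
    egf (fun n => 2 ^ n * E n (1 / 2)) *
      (egf (fun n => 1 ^ n) + egf (fun n => (-1) ^ n)) = 2 := by
  have h : egf (fun n => 2 ^ n * E n (1 / 2)) * (1 + egf (fun n => 2 ^ n))
      = 2 * egf (fun n => 1 ^ n) := by
    rw [mul_add, mul_one, egf_mul, egf_add, two_mul, egf_add]
    congr 1
    funext n
    have := congrArg (fun z => 2 ^ n * z) (hE n (1 / 2))
    simp only [mul_add, Finset.mul_sum] at this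
    rw [Finset.sum_congr rfl (g := fun r => 2 ^ n * ((n.choose r : ℂ) * E r (1 / 2)))]
    · rw [this, one_div, inv_pow]
      field_simp
      norm_num
    · intro r hr
      have hrn : r ≤ n := Nat.lt_succ_iff.mp (mem_range.mp hr)
      rw [← Nat.add_sub_of_le hrn, pow_add]
      simp only [Nat.add_sub_cancel_left]
      ring
  have h1 : egf (fun n => 1 ^ n) * egf (fun n => (-1) ^ n) = 1 := by
    rw [egf_pow_mul_egf_pow, add_neg_cancel, egf_zero_pow]
  have h2 : egf (fun n => 2 ^ n) * egf (fun n => (-1) ^ n) = egf (fun n => 1 ^ n) := by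
    rw [egf_pow_mul_egf_pow]
    norm_num
  linear_combination egf (fun n => (-1) ^ n) * h + 2 * h1
    - egf (fun n => 2 ^ n * E n (1 / 2)) * h2

theorem lehmer_sum_choose_euler_number (E : ℕ → ℂ → ℂ)
    (hE : ∀ n x, E n x + ∑ r ∈ Finset.range (n + 1), (n.choose r : ℂ) * E r x = 2 * x ^ n)
    (n : ℕ) (hn : 0 < n) (heven : Even n) :
    ∑ k ∈ (Finset.range (n + 1)).filter (fun k => 4 ∣ k),
      (n.choose k : ℂ) * (-4 : ℂ) ^ (k / 4) * (2 ^ (n - k) * E (n - k) (1 / 2))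
    = (-1 : ℂ) ^ (n / 2) := by
  have hA : egf (fun k => 4 * if 4 ∣ k then (-4 : ℂ) ^ (k / 4) else 0)
      = (egf (fun n => 1 ^ n) + egf (fun n => (-1) ^ n)) *
        (egf (fun n => Complex.I ^ n) + egf (fun n => (-Complex.I) ^ n)) := by
    simp only [← sum_pow_fourth_roots_neg_four, ← egf_add, ← egf_pow_mul_egf_pow]
    ring
  have hprod : egf (fun k => 4 * if 4 ∣ k then (-4 : ℂ) ^ (k / 4) else 0) *
      egf (fun n => 2 ^ n * E n (1 / 2))
      = (egf (fun n => Complex.I ^ n) + egf (fun n => (-Complex.I) ^ n)) +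
        (egf (fun n => Complex.I ^ n) + egf (fun n => (-Complex.I) ^ n)) := by
    rw [hA]
    linear_combination (egf (fun n => Complex.I ^ n) + egf (fun n => (-Complex.I) ^ n)) *
      egf_euler_mul E hE
  rw [egf_mul, egf_add, egf_add] at hprod
  have hcoeff := congrArg (PowerSeries.coeff n) hprod
  have hfac : (n.factorial : ℂ) ≠ 0 := by exact_mod_cast n.factorial_ne_zero
  rw [coeff_egf, coeff_egf, div_left_inj' hfac, heven.neg_pow] at hcoeff
  have hI : Complex.I ^ n = (-1) ^ (n / 2) := by
    rw [← Complex.I_sq, ← pow_mul, Nat.mul_div_cancel' heven.two_dvd]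
  rw [hI] at hcoeff
  refine mul_left_cancel₀ (show (4 : ℂ) ≠ 0 by norm_num) ?_
  rw [Finset.sum_filter, Finset.mul_sum]
  refine Eq.trans (Finset.sum_congr rfl fun k _ => ?_) (hcoeff.trans (by ring))
  split_ifs <;> ring
end

section
/- For every positive even integer n, Σ_{0 ≤ k ≤ n−1, 4 | k} C(n,k) (−1)^{k/4} 2^{(n-k)/2} (2^{n-k} − 1) B_{n-k} = (−1)^{⌊n/4⌋} n/2. -/
open Finset

namespace BernoulliFourSection

open PowerSeries

/-- The generating function `∑ (2 ^ m - 1) 2 ^ m B_m X ^ m / m!`, which equals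
`-2 X / (exp (2 X) + 1)`. -/
noncomputable def series : PowerSeries ℂ :=
  rescale 4 (bernoulliPowerSeries ℂ) - rescale 2 (bernoulliPowerSeries ℂ)

lemma coeff_series (m : ℕ) :
    coeff m series = (2 ^ m - 1) * 2 ^ m * (bernoulli m : ℂ) / (m.factorial : ℂ) := by
  simp only [series, bernoulliPowerSeries, map_sub, coeff_rescale, coeff_mk, eq_ratCast]
  rw [show (4 : ℂ) = 2 * 2 by norm_num, mul_pow]
  push_cast
  ring

lemma rescale_exp_sub_one_ne_zero : rescale (2 : ℂ) (exp ℂ) - 1 ≠ 0 := by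
  intro h
  have := congrArg (coeff 1) h
  simp [coeff_rescale, coeff_exp, coeff_one] at this

lemma series_mul_exp_add_one : series * (rescale 2 (exp ℂ) + 1) = -2 * X := by
  have h := bernoulliPowerSeries_mul_exp_sub_one ℂ
  have h4 := congrArg (rescale (4 : ℂ)) h
  have h2 := congrArg (rescale (2 : ℂ)) h
  have hE : rescale (2 : ℂ) (exp ℂ) * rescale (2 : ℂ) (exp ℂ) = rescale (4 : ℂ) (exp ℂ) := by
    rw [exp_mul_exp_eq_exp_add]
    norm_num
  simp only [map_mul, map_sub, map_one, rescale_X] at h4 h2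
  rw [← hE] at h4
  have c4 : (C (4 : ℂ) : PowerSeries ℂ) = 4 := map_ofNat _ 4
  have c2 : (C (2 : ℂ) : PowerSeries ℂ) = 2 := map_ofNat _ 2
  rw [c4] at h4
  rw [c2] at h2
  apply mul_right_cancel₀ rescale_exp_sub_one_ne_zero
  rw [series]
  linear_combination h4 - (rescale (2 : ℂ) (exp ℂ) + 1) * h2

/-- The power series `4 cosh X cos X`. -/
noncomputable def coshCos : PowerSeries ℂ :=
  rescale (1 + Complex.I) (exp ℂ) + rescale (1 - Complex.I) (exp ℂ)
    + rescale (-1 + Complex.I) (exp ℂ) + rescale (-1 - Complex.I) (exp ℂ)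

lemma pow_four_eq {z : ℂ} (h : z ^ 2 = 2 * Complex.I ∨ z ^ 2 = -2 * Complex.I) : z ^ 4 = -4 := by
  rcases h with h | h <;>
  · rw [show z ^ 4 = (z ^ 2) ^ 2 by ring, h, mul_pow, Complex.I_sq]
    norm_num

lemma one_add_I_sq : (1 + Complex.I) ^ 2 = 2 * Complex.I := by
  linear_combination Complex.I_sq

lemma one_sub_I_sq : (1 - Complex.I) ^ 2 = -2 * Complex.I := by
  linear_combination Complex.I_sq

lemma neg_one_add_I_sq : (-1 + Complex.I) ^ 2 = -2 * Complex.I := by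
  linear_combination Complex.I_sq

lemma neg_one_sub_I_sq : (-1 - Complex.I) ^ 2 = 2 * Complex.I := by
  linear_combination Complex.I_sq

lemma coeff_coshCos (k : ℕ) :
    coeff k coshCos = if 4 ∣ k then 4 * (-4) ^ (k / 4) / (k.factorial : ℂ) else 0 := by
  have key : (1 + Complex.I) ^ k + (1 - Complex.I) ^ k + (-1 + Complex.I) ^ k
      + (-1 - Complex.I) ^ k = if 4 ∣ k then 4 * (-4) ^ (k / 4) else 0 := by
    obtain ⟨q, r, hr, rfl⟩ : ∃ q r, r < 4 ∧ k = 4 * q + r :=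
      ⟨k / 4, k % 4, Nat.mod_lt _ (by norm_num), (Nat.div_add_mod k 4).symm⟩
    simp only [pow_add, pow_mul, pow_four_eq (.inl one_add_I_sq), pow_four_eq (.inr one_sub_I_sq),
      pow_four_eq (.inr neg_one_add_I_sq), pow_four_eq (.inl neg_one_sub_I_sq)]
    interval_cases r
    · simp
      ring
    · rw [if_neg (by omega)]
      ring
    · rw [if_neg (by omega), one_add_I_sq, one_sub_I_sq, neg_one_add_I_sq, neg_one_sub_I_sq]
      ring
    · rw [if_neg (by omega)]
      ring
  simp only [coshCos, map_add, coeff_rescale, coeff_exp, ← add_mul, key]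
  split_ifs <;> simp [div_eq_mul_inv]

lemma series_mul_coshCos :
    series * coshCos
      = -2 * X * (rescale (-1 + Complex.I) (exp ℂ) + rescale (-1 - Complex.I) (exp ℂ)) := by
  rw [← series_mul_exp_add_one, coshCos]
  have h1 := exp_mul_exp_eq_exp_add (A := ℂ) 2 (-1 + Complex.I)
  have h2 := exp_mul_exp_eq_exp_add (A := ℂ) 2 (-1 - Complex.I)
  rw [show (2 : ℂ) + (-1 + Complex.I) = 1 + Complex.I by ring] at h1
  rw [show (2 : ℂ) + (-1 - Complex.I) = 1 - Complex.I by ring] at h2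
  linear_combination -series * h1 - series * h2

lemma pow_add_pow_conj {n : ℕ} (h : Even (n + 1)) :
    (-1 + Complex.I) ^ n + (-1 - Complex.I) ^ n
      = -(-1) ^ ((n + 1) / 4) * 2 ^ ((n + 1) / 2) := by
  have hpow (q : ℕ) : (-4 : ℂ) ^ q = (-1) ^ q * 4 ^ q := by
    rw [← mul_pow]
    norm_num
  have htwo (q : ℕ) : (2 : ℂ) ^ (2 * q) = 4 ^ q := by
    rw [pow_mul]
    norm_num
  obtain ⟨q, hq | hq⟩ : ∃ q, n = 4 * q + 1 ∨ n = 4 * q + 3 := by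
    obtain ⟨m, hm⟩ := h
    exact ⟨n / 4, by omega⟩
  all_goals
    subst hq
    simp only [pow_add, pow_mul, pow_four_eq (.inr neg_one_add_I_sq),
      pow_four_eq (.inl neg_one_sub_I_sq), hpow]
  · rw [show (4 * q + 1 + 1) / 4 = q by omega, show (4 * q + 1 + 1) / 2 = 2 * q + 1 by omega,
      pow_succ (2 : ℂ), htwo]
    ring
  · rw [show (4 * q + 3 + 1) / 4 = q + 1 by omega, show (4 * q + 3 + 1) / 2 = 2 * q + 2 by omega,
      pow_add (2 : ℂ), htwo]
    linear_combination (-6 : ℂ) * (-1) ^ q * 4 ^ q * Complex.I_sq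

lemma coeff_series_mul_coshCos {n : ℕ} (hn : 0 < n) (heven : Even n) :
    (n.factorial : ℂ) * coeff n (series * coshCos)
      = 2 * n * (-1) ^ (n / 4) * 2 ^ (n / 2) := by
  obtain ⟨m, rfl⟩ : ∃ m, n = m + 1 := ⟨n - 1, by omega⟩
  have c2 : (-2 : PowerSeries ℂ) = C (-2 : ℂ) := by
    rw [map_neg, map_ofNat]
  have hm : (m.factorial : ℂ) ≠ 0 := by exact_mod_cast m.factorial_ne_zero
  rw [series_mul_coshCos, c2, mul_assoc, coeff_C_mul, coeff_succ_X_mul]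
  simp only [map_add, coeff_rescale, coeff_exp, ← add_mul, pow_add_pow_conj heven,
    Nat.factorial_succ]
  simp
  field_simp

end BernoulliFourSection

open BernoulliFourSection in
theorem sum_choose_two_pow_sub_one_bernoulli (n : ℕ) (hn : 0 < n) (heven : Even n) :
    ∑ k ∈ (Finset.range n).filter (fun k => 4 ∣ k),
      (n.choose k : ℚ) * (-1 : ℚ) ^ (k / 4) * 2 ^ ((n - k) / 2) * (2 ^ (n - k) - 1)
        * bernoulli (n - k)
    = (-1 : ℚ) ^ (n / 4) * (n : ℚ) / 2 := by
  have h := coeff_series_mul_coshCos hn heven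
  rw [mul_comm series, PowerSeries.coeff_mul, Finset.Nat.sum_antidiagonal_eq_sum_range_succ_mk,
    Finset.sum_range_succ, _root_.mul_add] at h
  have hlast : PowerSeries.coeff (n - n) series = 0 := by simp [coeff_series]
  rw [hlast, mul_zero, mul_zero, add_zero, Finset.mul_sum] at h
  have h2 : (4 * 2 ^ (n / 2) : ℂ) ≠ 0 := by simp
  have hterm : ∀ k ∈ Finset.range n,
      (n.factorial : ℂ) * (PowerSeries.coeff k coshCos * PowerSeries.coeff (n - k) series)
        = 4 * 2 ^ (n / 2) * if 4 ∣ k then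
          (n.choose k : ℂ) * (-1 : ℂ) ^ (k / 4) * 2 ^ ((n - k) / 2) * (2 ^ (n - k) - 1)
            * (bernoulli (n - k) : ℂ) else 0 := by
    intro k hk
    rw [Finset.mem_range] at hk
    rw [coeff_coshCos, coeff_series]
    split_ifs with h4
    · have hpow : (-4 : ℂ) ^ (k / 4) * 2 ^ (n - k)
          = (-1) ^ (k / 4) * (2 ^ (n / 2) * 2 ^ ((n - k) / 2)) := by
        rw [show (-4 : ℂ) = (-1) * 2 ^ 2 by norm_num, mul_pow, ← pow_mul, mul_assoc, ← pow_add,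
          ← pow_add]
        obtain ⟨a, rfl⟩ := heven
        obtain ⟨b, rfl⟩ := h4
        congr 2
        omega
      have hk' : (k.factorial : ℂ) ≠ 0 := by exact_mod_cast k.factorial_ne_zero
      have hnk : ((n - k).factorial : ℂ) ≠ 0 := by exact_mod_cast (n - k).factorial_ne_zero
      rw [Nat.cast_choose ℂ hk.le]
      field_simp
      linear_combination (n.factorial : ℂ) * (2 ^ (n - k) - 1 : ℂ) * (bernoulli (n - k) : ℂ) * hpow
    · simp
  rw [Finset.sum_congr rfl hterm, ← Finset.mul_sum, ← Finset.sum_filter] at h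
  have hC : ((∑ k ∈ (Finset.range n).filter (fun k => 4 ∣ k),
      (n.choose k : ℚ) * (-1 : ℚ) ^ (k / 4) * 2 ^ ((n - k) / 2) * (2 ^ (n - k) - 1)
        * bernoulli (n - k) : ℚ) : ℂ) = (((-1 : ℚ) ^ (n / 4) * (n : ℚ) / 2 : ℚ) : ℂ) := by
    push_cast
    apply mul_left_cancel₀ h2
    rw [h]
    ring
  exact_mod_cast hC
end
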